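/- Let ψ : ℝ² → ℂ be smooth and supported in the annulus {ξ : 1/4 ≤ ‖ξ‖ ≤ 2}. There is a constant C = C(ψ) such that for every k ∈ ℤ, every t > 0, and every Schwartz function u : ℝ² → ℂ, one has ( ∫_0^t ( sup_{x ∈ ℝ²} |(K_{k,s} ⋆ u)(x)| )² ds )^{1/2} ≤ C · 2^{3k/4} · ( √(max(k,0)) + √(log(1+t)) ) · ‖u‖_{L²(ℝ²)}. -/

import Mathlib

open MeasureTheory Complex
open scoped ENNReal RealInnerProductSpace

noncomputable section

/-- The kernel `K_{k,s}(z) = ∫_{ℝ²} e^{i(z·ξ − s‖ξ‖^{1/2})} ψ(2^{−k}ξ) dξ` of the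
frequency-localized linear evolution `e^{−isΛ}`, `Λ(ξ) = ‖ξ‖^{1/2}`, of the gravity water
wave equation. -/
def waveKernel (ψ : EuclideanSpace ℝ (Fin 2) → ℂ) (k : ℤ) (s : ℝ)
    (z : EuclideanSpace ℝ (Fin 2)) : ℂ :=
  ∫ ξ : EuclideanSpace ℝ (Fin 2),
    Complex.exp (Complex.I * ((⟪z, ξ⟫ - s * Real.sqrt ‖ξ‖ : ℝ) : ℂ)) * ψ ((2 : ℝ) ^ (-k) • ξ)

section FourierDecay

open scoped FourierTransform

variable {P V : Type*} [NormedAddCommGroup P] [NormedSpace ℝ P]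
  [NormedAddCommGroup V] [InnerProductSpace ℝ V]

theorem norm_iteratedFDeriv_slice_le {F : P × V → ℂ} (hF : ContDiff ℝ (⊤ : ℕ∞) F)
    (j : ℕ) (p : P) (v : V) :
    ‖iteratedFDeriv ℝ j (fun v => F (p, v)) v‖ ≤ ‖iteratedFDeriv ℝ j F (p, v)‖ := by
  have hG : ContDiff ℝ (⊤ : ℕ∞) (fun q : P × V => F ((p, 0) + q)) := by fun_prop
  have h1 : (fun v => F (p, v)) =
      (fun q : P × V => F ((p, 0) + q)) ∘ (ContinuousLinearMap.inr ℝ P V) := by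
    ext v; simp
  rw [h1, ContinuousLinearMap.iteratedFDeriv_comp_right _ hG v (i := j) (by exact_mod_cast le_top),
    iteratedFDeriv_comp_add_left]
  refine (ContinuousMultilinearMap.norm_compContinuousLinearMap_le _ _).trans ?_
  have h2 : ((p, 0) : P × V) + (ContinuousLinearMap.inr ℝ P V) v = (p, v) := by simp
  rw [h2]
  refine mul_le_of_le_one_right (norm_nonneg _) ?_
  exact Finset.prod_le_one (fun _ _ => norm_nonneg _)
    (fun _ _ => ContinuousLinearMap.norm_inr_le_one ℝ P V)

variable [FiniteDimensional ℝ V] [MeasurableSpace V] [BorelSpace V]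

/-- Fourier integrals of a smooth family of functions with uniformly bounded supports decay
rapidly, uniformly in compact sets of parameters. -/
theorem exists_norm_integral_exp_inner_mul_le {F : P × V → ℂ} (hF : ContDiff ℝ (⊤ : ℕ∞) F)
    {K : Set P} (hK : IsCompact K) {R : ℝ} (hR : ∀ p v, R < ‖v‖ → F (p, v) = 0) :
    ∃ C : ℝ, 0 < C ∧ ∀ p ∈ K, ∀ ζ : V,
      ‖∫ v, exp (I * (⟪ζ, v⟫ : ℝ)) * F (p, v)‖ ≤ C * (1 + ‖ζ‖) ^ (-3 : ℝ) := by
  have hslice : ∀ p, ContDiff ℝ (⊤ : ℕ∞) (fun v => F (p, v)) := fun p => by fun_prop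
  have hsupp : ∀ p, tsupport (fun v => F (p, v)) ⊆ Metric.closedBall 0 R := fun p => by
    refine closure_minimal (fun v hv => ?_) Metric.isClosed_closedBall
    by_contra h
    exact hv (hR p v (by simpa using h))
  have hint : ∀ p (j : ℕ), Integrable (fun v => ‖iteratedFDeriv ℝ j (fun v => F (p, v)) v‖) := by
    intro p j
    refine Continuous.integrable_of_hasCompactSupport
      ((hslice p).continuous_iteratedFDeriv (by exact_mod_cast le_top)).norm ?_
    refine HasCompactSupport.norm (HasCompactSupport.iteratedFDeriv ?_ j)
    exact (isCompact_closedBall (0 : V) R).of_isClosed_subset (isClosed_tsupport _) (hsupp p)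
  have hM : ∀ j : ℕ, ∃ M : ℝ, ∀ p ∈ K,
      ∫ v, ‖iteratedFDeriv ℝ j (fun v => F (p, v)) v‖ ≤ M := by
    intro j
    obtain ⟨M, hM⟩ := (hK.prod (isCompact_closedBall (0 : V) R)).exists_bound_of_continuousOn
      (hF.continuous_iteratedFDeriv (m := j) (by exact_mod_cast le_top)).continuousOn
    refine ⟨∫ v, (Metric.closedBall (0 : V) R).indicator (fun _ => M) v, fun p hp => ?_⟩
    refine integral_mono (hint p j) ?_ fun v => ?_
    · exact (integrable_indicator_iff Metric.isClosed_closedBall.measurableSet).2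
        (integrableOn_const (isCompact_closedBall (0 : V) R).measure_lt_top.ne)
    · by_cases hv : v ∈ Metric.closedBall (0 : V) R
      · rw [Set.indicator_of_mem hv]
        exact (norm_iteratedFDeriv_slice_le hF j p v).trans (hM (p, v) ⟨hp, hv⟩)
      · rw [Set.indicator_of_notMem hv]
        have : iteratedFDeriv ℝ j (fun v => F (p, v)) v = 0 := by
          by_contra h
          exact hv (hsupp p (support_iteratedFDeriv_subset j h))
        simp [this]
  choose M hM using hM
  have hbd : ∀ p ∈ K, ∀ (n : ℕ) (w : V), ‖w‖ ^ n * ‖𝓕 (fun v => F (p, v)) w‖ ≤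
      2 ^ n * ∑ j ∈ Finset.range (n + 1), M j := by
    intro p hp n w
    have h := Real.pow_mul_norm_iteratedFDeriv_fourier_le (f := fun v => F (p, v))
      (K := 0) (N := ⊤) (hslice p) (fun k n hk _ => by
        have : k = 0 := by simpa using hk
        simpa [this] using hint p n) (k := 0) (n := n) le_rfl le_top w
    simp only [norm_iteratedFDeriv_zero, pow_zero, one_mul, CharP.cast_eq_zero, mul_zero, zero_add,
      Finset.range_one, Finset.sum_product, Finset.sum_singleton] at h
    exact h.trans (mul_le_mul_of_nonneg_left
      (Finset.sum_le_sum fun j _ => hM j p hp) (by positivity))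
  set A := ∑ j ∈ Finset.range (0 + 1), M j
  set B := 2 ^ 3 * ∑ j ∈ Finset.range (3 + 1), M j
  refine ⟨|4 * (A + (2 * Real.pi) ^ 3 * B)| + 1, by positivity, fun p hp ζ => ?_⟩
  set w : V := (-(2 * Real.pi)⁻¹) • ζ with hw
  have hfour : ∫ v, exp (I * (⟪ζ, v⟫ : ℝ)) * F (p, v) = 𝓕 (fun v => F (p, v)) w := by
    rw [Real.fourier_eq']
    refine integral_congr_ae (Filter.Eventually.of_forall fun v => ?_)
    simp only [smul_eq_mul, hw, inner_smul_right, real_inner_comm]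
    congr 2
    have : (Real.pi : ℂ) ≠ 0 := by exact_mod_cast Real.pi_ne_zero
    push_cast
    field_simp
  have hζ : ‖ζ‖ = 2 * Real.pi * ‖w‖ := by
    rw [hw, norm_smul, norm_neg, norm_inv, Real.norm_of_nonneg (by positivity)]
    have := Real.pi_ne_zero
    field_simp
  rw [hfour, Real.rpow_neg (by positivity), ← div_eq_mul_inv, le_div_iff₀ (by positivity)]
  have h0 := hbd p hp 0 w
  have h3 := hbd p hp 3 w
  norm_num at h0
  set X := ‖𝓕 (fun v => F (p, v)) w‖
  have hX : 0 ≤ X := norm_nonneg _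
  have h1 : (1 + ‖ζ‖) ^ 3 ≤ 4 * (1 + ‖ζ‖ ^ 3) := by
    nlinarith [norm_nonneg ζ, mul_nonneg (norm_nonneg ζ) (sq_nonneg (‖ζ‖ - 1)), sq_nonneg (‖ζ‖ - 1)]
  calc X * (1 + ‖ζ‖) ^ (3 : ℝ) = X * (1 + ‖ζ‖) ^ 3 := by norm_cast
    _ ≤ X * (4 * (1 + ‖ζ‖ ^ 3)) := by gcongr
    _ = 4 * (X + (2 * Real.pi) ^ 3 * (‖w‖ ^ 3 * X)) := by rw [hζ]; ring
    _ ≤ 4 * (A + (2 * Real.pi) ^ 3 * B) := by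
      have : X ≤ A := by simpa [A] using h0
      gcongr
    _ ≤ _ := (le_abs_self _).trans (by linarith)

end FourierDecay

section PhaseExpansion

variable {V : Type*} [NormedAddCommGroup V] [InnerProductSpace ℝ V]

/-- The second order remainder `H` in
`√‖c + εη‖ = √‖c‖ + ε ⟪∇√‖·‖(c), η⟫ + ε² H(c, ε, η)`, in closed form. -/
def phaseRemainder (c : V) (ε : ℝ) (η : V) : ℝ :=
  ‖η‖ ^ 2 / ((√‖c + ε • η‖ + √‖c‖) * (‖c + ε • η‖ + ‖c‖)) -
    2 * ⟪c, η⟫ * (2 * ⟪c, η⟫ + ε * ‖η‖ ^ 2) *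
      (‖c + ε • η‖ + 2 * √‖c + ε • η‖ * √‖c‖ + 3 * ‖c‖) /
      (((√‖c + ε • η‖ + √‖c‖) * (‖c + ε • η‖ + ‖c‖)) ^ 2 * (4 * √‖c‖ ^ 3))

/-- The gradient of `√‖·‖` away from the origin. -/
def sqrtNormGrad (c : V) : V := (2 * √‖c‖ ^ 3)⁻¹ • c

theorem sqrt_norm_add_smul {c : V} (hc : c ≠ 0) (ε : ℝ) (η : V) :
    √‖c + ε • η‖ = √‖c‖ + ε * ⟪sqrtNormGrad c, η⟫ + ε ^ 2 * phaseRemainder c ε η := by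
  have hA : ‖c + ε • η‖ ^ 2 = ‖c‖ ^ 2 + ε * (2 * ⟪c, η⟫ + ε * ‖η‖ ^ 2) := by
    rw [norm_add_sq_real, inner_smul_right, norm_smul, mul_pow, Real.norm_eq_abs, sq_abs]; ring
  have hb : 0 < √‖c‖ := Real.sqrt_pos.2 (norm_pos_iff.2 hc)
  have ha : 0 ≤ √‖c + ε • η‖ := Real.sqrt_nonneg _
  have hb2 : ‖c‖ = √‖c‖ ^ 2 := (Real.sq_sqrt (norm_nonneg _)).symm
  have ha2 : ‖c + ε • η‖ = √‖c + ε • η‖ ^ 2 := (Real.sq_sqrt (norm_nonneg _)).symm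
  rw [phaseRemainder, sqrtNormGrad, real_inner_smul_left]
  generalize √‖c + ε • η‖ = a at *
  generalize √‖c‖ = b at *
  rw [ha2, hb2] at hA ⊢
  set i := ⟪c, η⟫
  set n := ‖η‖ ^ 2
  have hD : 0 < (a + b) * (a ^ 2 + b ^ 2) := by positivity
  set D := (a + b) * (a ^ 2 + b ^ 2) with hDdef
  have hdiff : ε * (2 * i + ε * n) = (a - b) * D := by rw [hDdef]; linear_combination -hA
  have h1 : 2 * i * (2 * i + ε * n) * (a ^ 2 + 2 * a * b + 3 * b ^ 2) * ε
      = 2 * i * D * (D - 4 * b ^ 3) := by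
    have : (a - b) * (a ^ 2 + 2 * a * b + 3 * b ^ 2) = D - 4 * b ^ 3 := by rw [hDdef]; ring
    rw [← this]; linear_combination 2 * i * (a ^ 2 + 2 * a * b + 3 * b ^ 2) * hdiff
  have h2 : a - b = ε * ((2 * i + ε * n) / D) := by field_simp; linear_combination -hdiff
  have h3 : ε ^ 2 * (2 * i * (2 * i + ε * n) * (a ^ 2 + 2 * a * b + 3 * b ^ 2) /
      (D ^ 2 * (4 * b ^ 3))) = ε * (2 * i * D * (D - 4 * b ^ 3)) / (D ^ 2 * (4 * b ^ 3)) := by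
    rw [← h1]; ring
  rw [mul_sub, h3, show a = b + (a - b) by ring, h2]
  field_simp
  ring

theorem contDiffAt_phaseRemainder {q : (V × ℝ) × V} (h0 : q.1.1 ≠ 0)
    (h1 : q.1.1 + q.1.2 • q.2 ≠ 0) :
    ContDiffAt ℝ (⊤ : ℕ∞) (fun q : (V × ℝ) × V => phaseRemainder q.1.1 q.1.2 q.2) q := by
  have hl0 : ContDiffAt ℝ (⊤ : ℕ∞) (fun q : (V × ℝ) × V => q.1.1) q := by fun_prop
  have hl1 : ContDiffAt ℝ (⊤ : ℕ∞) (fun q : (V × ℝ) × V => q.1.1 + q.1.2 • q.2) q := by fun_prop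
  have hη : ContDiffAt ℝ (⊤ : ℕ∞) (fun q : (V × ℝ) × V => ‖q.2‖ ^ 2) q :=
    (contDiff_snd.norm_sq ℝ).contDiffAt
  have hε : ContDiffAt ℝ (⊤ : ℕ∞) (fun q : (V × ℝ) × V => q.1.2) q := by fun_prop
  have hi : ContDiffAt ℝ (⊤ : ℕ∞) (fun q : (V × ℝ) × V => ⟪q.1.1, q.2⟫) q :=
    ContDiffAt.inner ℝ (by fun_prop) (by fun_prop)
  have hb := hl0.norm ℝ h0
  have ha := hl1.norm ℝ h1
  have hsb := hb.sqrt (norm_ne_zero_iff.2 h0)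
  have hsa := ha.sqrt (norm_ne_zero_iff.2 h1)
  have pb := norm_pos_iff.2 h0
  have pa := norm_pos_iff.2 h1
  have hD := (hsa.add hsb).mul (ha.add hb)
  have pD : 0 < (√‖q.1.1 + q.1.2 • q.2‖ + √‖q.1.1‖) * (‖q.1.1 + q.1.2 • q.2‖ + ‖q.1.1‖) := by
    positivity
  unfold phaseRemainder
  refine (hη.div hD pD.ne').sub (ContDiffAt.div ?_ ?_ ?_)
  · exact ((contDiffAt_const.mul hi).mul ((contDiffAt_const.mul hi).add (hε.mul hη))).mul
      ((ha.add ((contDiffAt_const.mul hsa).mul hsb)).add (contDiffAt_const.mul hb))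
  · exact (hD.pow 2).mul (contDiffAt_const.mul (hsb.pow 3))
  · positivity

/-- The gradient of `√‖·‖` is injective with Lipschitz inverse on bounded sets. -/
theorem norm_sub_le_sqrtNormGrad {c d : V} (hc : c ≠ 0) (hd : d ≠ 0) (hc3 : ‖c‖ ≤ 3)
    (hd3 : ‖d‖ ≤ 3) : ‖c - d‖ ≤ 32 * ‖sqrtNormGrad c - sqrtNormGrad d‖ := by
  have hp : 0 < √‖c‖ := Real.sqrt_pos.2 (norm_pos_iff.2 hc)
  have hq : 0 < √‖d‖ := Real.sqrt_pos.2 (norm_pos_iff.2 hd)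
  have hp2 : √‖c‖ ≤ 2 := by rw [Real.sqrt_le_left (by norm_num)]; linarith
  have hq2 : √‖d‖ ≤ 2 := by rw [Real.sqrt_le_left (by norm_num)]; linarith
  have hcp : ‖c‖ = √‖c‖ ^ 2 := (Real.sq_sqrt (norm_nonneg _)).symm
  have hdq : ‖d‖ = √‖d‖ ^ 2 := (Real.sq_sqrt (norm_nonneg _)).symm
  have hI : ⟪c, d⟫ ≤ ‖c‖ * ‖d‖ := real_inner_le_norm c d
  refine le_of_sq_le_sq ?_ (by positivity)
  rw [mul_pow, norm_sub_sq_real, norm_sub_sq_real, sqrtNormGrad, sqrtNormGrad, norm_smul,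
    norm_smul, real_inner_smul_left, inner_smul_right, norm_inv, norm_inv,
    Real.norm_of_nonneg (by positivity), Real.norm_of_nonneg (by positivity)]
  generalize √‖c‖ = p at *
  generalize √‖d‖ = q at *
  rw [hcp, hdq] at hI ⊢
  generalize ⟪c, d⟫ = i at *
  have key : ((2 * p ^ 3)⁻¹ * p ^ 2) ^ 2 - 2 * ((2 * p ^ 3)⁻¹ * ((2 * q ^ 3)⁻¹ * i)) +
      ((2 * q ^ 3)⁻¹ * q ^ 2) ^ 2 = (p * q ^ 3 + q * p ^ 3 - 2 * i) / (4 * p ^ 3 * q ^ 3) := by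
    field_simp
    ring
  rw [key, ← mul_div_assoc, le_div_iff₀ (by positivity)]
  set N := (p ^ 2) ^ 2 - 2 * i + (q ^ 2) ^ 2 with hN
  have hN1 : (p - q) ^ 2 * (p + q) ^ 2 ≤ N := by rw [hN]; nlinarith
  have hN0 : 0 ≤ N := le_trans (by positivity) hN1
  have hM : p * q ^ 3 + q * p ^ 3 - 2 * i = N - (p - q) ^ 2 * ((p + q) ^ 2 - p * q) := by
    rw [hN]; ring
  have h1 : N * (p * q) ≤ (p + q) ^ 2 * (N - (p - q) ^ 2 * ((p + q) ^ 2 - p * q)) := by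
    have : 0 ≤ (p + q) ^ 2 - p * q := by nlinarith
    nlinarith [mul_le_mul_of_nonneg_right hN1 this]
  have h2 : (p + q) ^ 2 ≤ 16 := by nlinarith
  have hM0 : 0 ≤ N - (p - q) ^ 2 * ((p + q) ^ 2 - p * q) := by
    have h3 : 0 ≤ N * (p * q) := by positivity
    by_contra h
    have : (p + q) ^ 2 * (N - (p - q) ^ 2 * ((p + q) ^ 2 - p * q)) < 0 :=
      mul_neg_of_pos_of_neg (by positivity) (by linarith)
    linarith
  rw [hM]
  have h3 : N * (p * q) ≤ 16 * (N - (p - q) ^ 2 * ((p + q) ^ 2 - p * q)) :=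
    h1.trans (mul_le_mul_of_nonneg_right h2 hM0)
  have h4 : (p * q) ^ 2 ≤ 16 := by
    have : p * q ≤ 4 := by nlinarith
    nlinarith [mul_pos hp hq]
  calc N * (4 * p ^ 3 * q ^ 3) = 4 * (N * (p * q)) * (p * q) ^ 2 := by ring
    _ ≤ 4 * (N * (p * q)) * 16 := by gcongr
    _ ≤ _ := by linarith

end PhaseExpansion

section Dispersive

variable {V : Type*} [NormedAddCommGroup V] [InnerProductSpace ℝ V]

/-- The amplitude of the oscillatory integral localized at scale `ε` around the frequency `c`,
after extraction of the affine part of the phase. -/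
def localAmplitude (φ : V → ℂ) (χ κ : ContDiffBump (0 : V)) (q : (V × ℝ) × V) : ℂ :=
  ((1 - κ q.1.1 : ℝ) : ℂ) * (χ q.2 : ℝ) * φ (q.1.1 + q.1.2 • q.2) *
    exp (-I * (phaseRemainder q.1.1 q.1.2 q.2 : ℝ))

theorem continuous_oscillatory {φ : V → ℂ} (hφ : Continuous φ) (z : V) (s : ℝ) :
    Continuous fun ξ => exp (I * ((⟪z, ξ⟫ - s * √‖ξ‖ : ℝ) : ℂ)) * φ ξ := by
  fun_prop

theorem norm_exp_I_mul_ofReal_mul (x : ℝ) (w : ℂ) : ‖exp (I * (x : ℂ)) * w‖ = ‖w‖ := by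
  rw [norm_mul, mul_comm I, norm_exp_ofReal_mul_I, one_mul]

theorem contDiff_localAmplitude [HasContDiffBump V] {φ : V → ℂ} (hφ : ContDiff ℝ (⊤ : ℕ∞) φ)
    (h0 : (0 : V) ∉ tsupport φ) (χ κ : ContDiffBump (0 : V)) :
    ContDiff ℝ (⊤ : ℕ∞) (localAmplitude φ χ κ) := by
  rw [contDiff_iff_contDiffAt]
  intro q
  have hκ : ContDiff ℝ (⊤ : ℕ∞) (fun q : (V × ℝ) × V => ((1 - κ q.1.1 : ℝ) : ℂ)) :=
    Complex.ofRealCLM.contDiff.comp (contDiff_const.sub (κ.contDiff.comp (by fun_prop)))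
  have hχ : ContDiff ℝ (⊤ : ℕ∞) (fun q : (V × ℝ) × V => ((χ q.2 : ℝ) : ℂ)) :=
    Complex.ofRealCLM.contDiff.comp (χ.contDiff.comp (by fun_prop))
  have hφ' : ContDiff ℝ (⊤ : ℕ∞) (fun q : (V × ℝ) × V => φ (q.1.1 + q.1.2 • q.2)) := by fun_prop
  have hcont : Continuous (fun q : (V × ℝ) × V => q.1.1 + q.1.2 • q.2) := by fun_prop
  by_cases hc : q.1.1 = 0
  · refine (contDiffAt_const (c := (0 : ℂ))).congr_of_eventuallyEq ?_
    have hk := κ.eventuallyEq_one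
    have ht : Filter.Tendsto (fun q : (V × ℝ) × V => q.1.1) (nhds q) (nhds 0) := by
      rw [← hc]; exact (by fun_prop : Continuous fun q : (V × ℝ) × V => q.1.1).tendsto q
    filter_upwards [ht.eventually hk] with r hr
    simp [localAmplitude, hr]
  by_cases hl : q.1.1 + q.1.2 • q.2 = 0
  · refine (contDiffAt_const (c := (0 : ℂ))).congr_of_eventuallyEq ?_
    have hk := notMem_tsupport_iff_eventuallyEq.1 h0
    have ht : Filter.Tendsto (fun q : (V × ℝ) × V => q.1.1 + q.1.2 • q.2) (nhds q) (nhds 0) := by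
      rw [← hl]; exact hcont.tendsto q
    filter_upwards [ht.eventually hk] with r hr
    simp [localAmplitude, hr]
  · have hH := Complex.ofRealCLM.contDiff.contDiffAt.comp q (contDiffAt_phaseRemainder hc hl)
    exact ((hκ.mul hχ).mul hφ').contDiffAt.mul ((contDiffAt_const.mul hH).cexp)

variable [FiniteDimensional ℝ V] [MeasurableSpace V] [BorelSpace V]

/-- Averaging an oscillatory integral over translations at scale `ε`. -/
theorem integral_bump_mul_integral {g : V → ℂ} (hg : Continuous g) (hgs : HasCompactSupport g)
    (χ : ContDiffBump (0 : V)) (ε : ℝ) :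
    ((∫ η, χ η : ℝ) : ℂ) * ∫ ξ, g ξ = ∫ c, ∫ η, (χ η : ℂ) * g (c + ε • η) := by
  have hcont : Continuous (fun q : V × V => (χ q.2 : ℂ) * g (q.1 + ε • q.2)) := by
    have := χ.continuous
    fun_prop
  have hsupp : HasCompactSupport (fun q : V × V => (χ q.2 : ℂ) * g (q.1 + ε • q.2)) := by
    have hK : IsCompact ((fun q : V × V => (q.1 - ε • q.2, q.2)) ''
        (tsupport g ×ˢ Metric.closedBall (0 : V) χ.rOut)) :=
      (hgs.isCompact.prod (isCompact_closedBall _ _)).image (by fun_prop)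
    refine HasCompactSupport.intro hK fun q hq => ?_
    by_contra h
    refine hq ⟨(q.1 + ε • q.2, q.2), ⟨subset_tsupport _ (right_ne_zero_of_mul h), ?_⟩, by simp⟩
    have : χ q.2 ≠ 0 := by simpa using left_ne_zero_of_mul h
    have h2 : q.2 ∈ Function.support χ := this
    rw [χ.support_eq] at h2
    exact Metric.ball_subset_closedBall h2
  rw [integral_integral_swap (hcont.integrable_of_hasCompactSupport hsupp)]
  simp_rw [integral_const_mul, integral_add_right_eq_self g]
  rw [integral_mul_const, integral_complex_ofReal]

theorem integral_bump_mul_oscillatory_eq (φ : V → ℂ) {χ κ : ContDiffBump (0 : V)} {c : V}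
    (hc : c ≠ 0) (hκ : κ c = 0) {ε : ℝ} (hε : 0 < ε) (z : V) :
    ‖∫ η, (χ η : ℂ) * (exp (I * ((⟪z, c + ε • η⟫ - (ε ^ 2)⁻¹ * √‖c + ε • η‖ : ℝ) : ℂ)) *
        φ (c + ε • η))‖ =
      ‖∫ η, exp (I * (⟪ε • z - ε⁻¹ • sqrtNormGrad c, η⟫ : ℝ)) *
        localAmplitude φ χ κ ((c, ε), η)‖ := by
  rw [← norm_exp_I_mul_ofReal_mul (⟪z, c⟫ - (ε ^ 2)⁻¹ * √‖c‖)
    (∫ η, exp (I * (⟪ε • z - ε⁻¹ • sqrtNormGrad c, η⟫ : ℝ)) * localAmplitude φ χ κ ((c, ε), η)),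
    ← integral_const_mul]
  congr 2
  ext η
  simp only [localAmplitude, hκ]
  have h : ⟪z, c + ε • η⟫ - (ε ^ 2)⁻¹ * √‖c + ε • η‖ = (⟪z, c⟫ - (ε ^ 2)⁻¹ * √‖c‖) +
      (⟪ε • z - ε⁻¹ • sqrtNormGrad c, η⟫ + -phaseRemainder c ε η) := by
    rw [sqrt_norm_add_smul hc, inner_add_right, inner_smul_right, inner_sub_left,
      real_inner_smul_left, real_inner_smul_left]
    field_simp
    ring
  rw [h, ofReal_add, ofReal_add (⟪ε • z - ε⁻¹ • sqrtNormGrad c, η⟫), mul_add, mul_add,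
    Complex.exp_add, Complex.exp_add]
  push_cast
  ring_nf

/-- Dispersive estimate in two dimensions for the phase `√‖ξ‖`. -/
theorem exists_dispersive_nonneg (hd : Module.finrank ℝ V = 2) {φ : V → ℂ}
    (hφ : ContDiff ℝ (⊤ : ℕ∞) φ) (hsupp : tsupport φ ⊆ {ξ | 1 / 4 ≤ ‖ξ‖ ∧ ‖ξ‖ ≤ 2}) :
    ∃ C : ℝ, 0 < C ∧ ∀ s : ℝ, 0 ≤ s → ∀ z : V,
      ‖∫ ξ, exp (I * ((⟪z, ξ⟫ - s * √‖ξ‖ : ℝ) : ℂ)) * φ ξ‖ ≤ C / (1 + s) := by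
  have hφc : HasCompactSupport φ :=
    (isCompact_closedBall (0 : V) 2).of_isClosed_subset (isClosed_tsupport _)
      fun ξ hξ => by simpa using (hsupp hξ).2
  have hφ0 : ∀ ξ, φ ξ ≠ 0 → 1 / 4 ≤ ‖ξ‖ ∧ ‖ξ‖ ≤ 2 := fun ξ h => hsupp (subset_tsupport _ h)
  have hzero : (0 : V) ∉ tsupport φ := fun h => by
    have := (hsupp h).1
    norm_num at this
  let χ : ContDiffBump (0 : V) := ⟨1 / 2, 1, by norm_num, by norm_num⟩
  let κ : ContDiffBump (0 : V) := ⟨1 / 16, 1 / 8, by norm_num, by norm_num⟩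
  have hχ0 : ∀ η, χ η ≠ 0 → ‖η‖ < 1 := fun η h => by
    have : η ∈ Function.support χ := h
    rw [χ.support_eq] at this
    simpa [χ] using this
  have hκ0 : ∀ c : V, 1 / 8 ≤ ‖c‖ → κ c = 0 := fun c h => κ.zero_of_le_dist (by simpa [κ] using h)
  set A : Set V := {c | 1 / 8 ≤ ‖c‖ ∧ ‖c‖ ≤ 3} with hA
  have hAc : IsCompact A := by
    refine (isCompact_closedBall (0 : V) 3).of_isClosed_subset ?_ fun c hc => by simpa using hc.2
    exact (isClosed_le continuous_const continuous_norm).inter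
      (isClosed_le continuous_norm continuous_const)
  have hA0 : ∀ c ∈ A, c ≠ 0 := fun c hc h => by
    have := hc.1
    rw [h] at this
    norm_num at this
  have hAne : A.Nonempty := by
    have : Nontrivial V := Module.nontrivial_of_finrank_pos (R := ℝ) (by omega)
    obtain ⟨x, hx⟩ := exists_norm_eq V (c := 1) zero_le_one
    exact ⟨x, by rw [hx]; norm_num, by rw [hx]; norm_num⟩
  have hGc : ContinuousOn (sqrtNormGrad (V := V)) A := by
    unfold sqrtNormGrad
    refine ContinuousOn.smul (ContinuousOn.inv₀ (by fun_prop) fun c hc => ?_) continuousOn_id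
    have : 0 < √‖c‖ := Real.sqrt_pos.2 (norm_pos_iff.2 (hA0 c hc))
    positivity
  obtain ⟨C₁, hC₁, hdecay⟩ := exists_norm_integral_exp_inner_mul_le
    (contDiff_localAmplitude hφ hzero χ κ) (hAc.prod (isCompact_Icc (a := (0 : ℝ)) (b := 1 / 16)))
    (R := 1) (fun p v hv => by
      have : χ v = 0 := by
        by_contra h
        exact absurd (hχ0 v h) (by linarith)
      simp [localAmplitude, this])
  set J := ∫ x : V, (1 + ‖x‖) ^ (-3 : ℝ) with hJ
  have hJint : Integrable (fun x : V => (1 + ‖x‖) ^ (-3 : ℝ)) :=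
    integrable_one_add_norm (by rw [hd]; norm_num)
  have hJ0 : 0 ≤ J := integral_nonneg fun x => by positivity
  set m := ∫ η, χ η with hm
  have hm0 : 0 < m := χ.integral_pos
  set N := ∫ ξ, ‖φ ξ‖ with hN
  have hN0 : 0 ≤ N := integral_nonneg fun x => norm_nonneg _
  refine ⟨2 * (C₁ * (4096 * J)) / m + 257 * N + 1, by positivity, fun s hs z => ?_⟩
  rw [le_div_iff₀ (by positivity)]
  rcases lt_or_ge s 256 with hs1 | hs1
  · have h1 : ‖∫ ξ, exp (I * ((⟪z, ξ⟫ - s * √‖ξ‖ : ℝ) : ℂ)) * φ ξ‖ ≤ N := by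
      refine (norm_integral_le_integral_norm _).trans_eq ?_
      simp_rw [norm_exp_I_mul_ofReal_mul]
      exact hN.symm
    have h2 : 0 ≤ 2 * (C₁ * (4096 * J)) / m := by positivity
    calc _ ≤ N * 257 := by gcongr; linarith
      _ ≤ _ := by linarith
  have hs0 : 0 < s := by linarith
  set ε := (√s)⁻¹ with hε
  have hε0 : 0 < ε := inv_pos.2 (Real.sqrt_pos.2 hs0)
  have hε1 : ε ≤ 1 / 16 := by
    rw [hε, one_div]
    refine inv_anti₀ (by norm_num) ?_
    rw [Real.le_sqrt (by norm_num) hs]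
    linarith
  have hεs : (ε ^ 2)⁻¹ = s := by rw [hε, inv_pow, inv_inv, Real.sq_sqrt hs]
  obtain ⟨c', hc'A, hc'⟩ := hAc.exists_isMinOn hAne
    (f := fun c => ‖ε ^ 2 • z - sqrtNormGrad c‖) (continuousOn_const.sub hGc).norm
  have hlocal : ∀ c, ‖∫ η, (χ η : ℂ) * (exp (I * ((⟪z, c + ε • η⟫ - s * √‖c + ε • η‖ : ℝ) : ℂ)) *
        φ (c + ε • η))‖ ≤ C₁ * (1 + ‖(ε⁻¹ / 64) • (c - c')‖) ^ (-3 : ℝ) := by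
    intro c
    by_cases hcA : c ∈ A
    · rw [← hεs, integral_bump_mul_oscillatory_eq φ (hA0 c hcA) (hκ0 c hcA.1) hε0 z]
      refine (hdecay (c, ε) ⟨hcA, hε0.le, hε1⟩ _).trans ?_
      refine mul_le_mul_of_nonneg_left ?_ hC₁.le
      refine Real.rpow_le_rpow_of_nonpos (by positivity) ?_ (by norm_num)
      have h1 : ε • z - ε⁻¹ • sqrtNormGrad c = ε⁻¹ • (ε ^ 2 • z - sqrtNormGrad c) := by
        rw [smul_sub, smul_smul]
        congr 2
        field_simp
      have h2 := norm_sub_le_sqrtNormGrad (hA0 c hcA) (hA0 c' hc'A) hcA.2 hc'A.2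
      have h3 : ‖sqrtNormGrad c - sqrtNormGrad c'‖ ≤
          ‖ε ^ 2 • z - sqrtNormGrad c‖ + ‖ε ^ 2 • z - sqrtNormGrad c'‖ := by
        rw [add_comm]
        exact (by congr 1; abel : ‖sqrtNormGrad c - sqrtNormGrad c'‖ =
          ‖(ε ^ 2 • z - sqrtNormGrad c') - (ε ^ 2 • z - sqrtNormGrad c)‖).trans_le
            (norm_sub_le _ _)
      have h4 : ‖ε ^ 2 • z - sqrtNormGrad c'‖ ≤ ‖ε ^ 2 • z - sqrtNormGrad c‖ := hc' hcA
      rw [h1, norm_smul, norm_smul, Real.norm_of_nonneg (by positivity),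
        Real.norm_of_nonneg (by positivity), div_mul_eq_mul_div, mul_div_assoc]
      gcongr
      linarith
    · have : ∀ η, (χ η : ℂ) * (exp (I * ((⟪z, c + ε • η⟫ - s * √‖c + ε • η‖ : ℝ) : ℂ)) *
        φ (c + ε • η)) = 0 := by
        intro η
        by_contra h
        have hη := hχ0 η (by simpa using left_ne_zero_of_mul h)
        have hl := hφ0 _ (right_ne_zero_of_mul (right_ne_zero_of_mul h))
        have hεη : ‖ε • η‖ ≤ 1 / 16 := by
          rw [norm_smul, Real.norm_of_nonneg hε0.le]
          nlinarith [norm_nonneg η]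
        have h1 := norm_add_le c (ε • η)
        have h2 := norm_sub_le (c + ε • η) (ε • η)
        rw [add_sub_cancel_right] at h2
        exact hcA ⟨by linarith, by linarith⟩
      simp only [this, integral_zero, norm_zero]
      positivity
  have hint : Integrable fun c : V => C₁ * (1 + ‖(ε⁻¹ / 64) • (c - c')‖) ^ (-3 : ℝ) :=
    (((hJint.comp_smul (R := ε⁻¹ / 64) (by positivity)).comp_sub_right c')).const_mul C₁
  have hmain : m * ‖∫ ξ, exp (I * ((⟪z, ξ⟫ - s * √‖ξ‖ : ℝ) : ℂ)) * φ ξ‖ ≤ C₁ * (4096 * J) * s⁻¹ := by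
    calc m * ‖∫ ξ, exp (I * ((⟪z, ξ⟫ - s * √‖ξ‖ : ℝ) : ℂ)) * φ ξ‖
        = ‖(m : ℂ) * ∫ ξ, exp (I * ((⟪z, ξ⟫ - s * √‖ξ‖ : ℝ) : ℂ)) * φ ξ‖ := by
          rw [norm_mul, Complex.norm_of_nonneg hm0.le]
      _ ≤ ∫ c : V, C₁ * (1 + ‖(ε⁻¹ / 64) • (c - c')‖) ^ (-3 : ℝ) := by
          rw [hm, integral_bump_mul_integral (continuous_oscillatory hφ.continuous z s)
            hφc.mul_left χ ε]
          exact norm_integral_le_of_norm_le hint (Filter.Eventually.of_forall hlocal)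
      _ = C₁ * (4096 * J) * s⁻¹ := by
          rw [integral_const_mul,
            integral_sub_right_eq_self (fun c : V => (1 + ‖(ε⁻¹ / 64) • c‖) ^ (-3 : ℝ)),
            Measure.integral_comp_smul volume (fun c : V => (1 + ‖c‖) ^ (-3 : ℝ)), hd, ← hεs,
            abs_of_nonneg (by positivity), smul_eq_mul, ← hJ]
          field_simp
          ring
  have h1 : s⁻¹ * (1 + s) ≤ 2 := by
    field_simp
    linarith
  have h2 : m * (‖∫ ξ, exp (I * ((⟪z, ξ⟫ - s * √‖ξ‖ : ℝ) : ℂ)) * φ ξ‖ * (1 + s)) ≤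
      2 * (C₁ * (4096 * J)) := by
    calc _ = (m * ‖∫ ξ, exp (I * ((⟪z, ξ⟫ - s * √‖ξ‖ : ℝ) : ℂ)) * φ ξ‖) * (1 + s) := by ring
      _ ≤ C₁ * (4096 * J) * s⁻¹ * (1 + s) := by gcongr
      _ = C₁ * (4096 * J) * (s⁻¹ * (1 + s)) := by ring
      _ ≤ C₁ * (4096 * J) * 2 := by gcongr
      _ = _ := by ring
  have h3 : ‖∫ ξ, exp (I * ((⟪z, ξ⟫ - s * √‖ξ‖ : ℝ) : ℂ)) * φ ξ‖ * (1 + s) ≤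
      2 * (C₁ * (4096 * J)) / m := by
    rw [le_div_iff₀ hm0]; linarith
  linarith

theorem exists_dispersive (hd : Module.finrank ℝ V = 2) {φ : V → ℂ}
    (hφ : ContDiff ℝ (⊤ : ℕ∞) φ) (hsupp : tsupport φ ⊆ {ξ | 1 / 4 ≤ ‖ξ‖ ∧ ‖ξ‖ ≤ 2})
    (hreal : ∀ ξ, (starRingEnd ℂ) (φ ξ) = φ ξ) :
    ∃ C : ℝ, 0 < C ∧ ∀ (s : ℝ) (z : V),
      ‖∫ ξ, exp (I * ((⟪z, ξ⟫ - s * √‖ξ‖ : ℝ) : ℂ)) * φ ξ‖ ≤ C / (1 + |s|) := by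
  obtain ⟨C, hC, h⟩ := exists_dispersive_nonneg hd hφ hsupp
  refine ⟨C, hC, fun s z => ?_⟩
  rcases le_total 0 s with hs | hs
  · rw [abs_of_nonneg hs]
    exact h s hs z
  · rw [abs_of_nonpos hs, ← norm_conj, ← integral_conj]
    refine le_of_eq_of_le ?_ (h (-s) (by linarith) (-z))
    congr 2
    ext ξ
    rw [map_mul, hreal, ← exp_conj, map_mul, conj_I, conj_ofReal, inner_neg_left]
    congr 2
    push_cast
    ring

/-- The dispersive estimate for frequencies of size `l`. -/
theorem exists_dispersive_scaled (hd : Module.finrank ℝ V = 2) {φ : V → ℂ}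
    (hφ : ContDiff ℝ (⊤ : ℕ∞) φ) (hsupp : tsupport φ ⊆ {ξ | 1 / 4 ≤ ‖ξ‖ ∧ ‖ξ‖ ≤ 2})
    (hreal : ∀ ξ, (starRingEnd ℂ) (φ ξ) = φ ξ) :
    ∃ C : ℝ, 0 < C ∧ ∀ l : ℝ, 0 < l → ∀ (s : ℝ) (z : V),
      ‖∫ ξ, exp (I * ((⟪z, ξ⟫ - s * √‖ξ‖ : ℝ) : ℂ)) * φ (l⁻¹ • ξ)‖ ≤
        C * l ^ 2 / (1 + √l * |s|) := by
  obtain ⟨C, hC, h⟩ := exists_dispersive hd hφ hsupp hreal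
  refine ⟨C, hC, fun l hl s z => ?_⟩
  set G : V → ℂ := fun ξ => exp (I * ((⟪l • z, ξ⟫ - √l * s * √‖ξ‖ : ℝ) : ℂ)) * φ ξ with hG
  have h1 : ∀ ξ : V, exp (I * ((⟪z, ξ⟫ - s * √‖ξ‖ : ℝ) : ℂ)) * φ (l⁻¹ • ξ) = G (l⁻¹ • ξ) := by
    intro ξ
    have h2 : √‖l⁻¹ • ξ‖ = (√l)⁻¹ * √‖ξ‖ := by
      rw [norm_smul, norm_inv, Real.norm_of_nonneg hl.le, Real.sqrt_mul (by positivity),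
        Real.sqrt_inv]
    have h3 : √l ≠ 0 := (Real.sqrt_pos.2 hl).ne'
    simp only [hG, h2, real_inner_smul_left, inner_smul_right]
    congr 5
    · field_simp
    · field_simp
  rw [integral_congr_ae (Filter.Eventually.of_forall h1), Measure.integral_comp_inv_smul, hd, norm_smul, Real.norm_eq_abs, abs_abs,
    abs_of_nonneg (by positivity), mul_comm C, mul_div_assoc]
  gcongr
  have h2 := h (√l * s) (l • z)
  rwa [abs_mul, abs_of_nonneg (Real.sqrt_nonneg l)] at h2

end Dispersive

section TTStar

variable {S X : Type*} [MeasurableSpace S] [MeasurableSpace X]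

/-- The `TT*` argument: an operator `g ↦ ∫ e(·, x) g(x) dx` is bounded on `L²` as soon as the
kernel of `TT*` satisfies Schur's test. -/
theorem integral_norm_sq_le_of_schur {ν : Measure S} [IsFiniteMeasure ν] {μ : Measure X}
    [SFinite μ] {e : S → X → ℂ} (he : Measurable (Function.uncurry e)) {b : X → ℝ}
    (hbm : AEStronglyMeasurable b μ) (hb : Integrable (fun x => b x ^ 2) μ)
    (heb : ∀ s x, ‖e s x‖ ≤ b x)
    {g : X → ℂ} (hgm : StronglyMeasurable g) (hg : Integrable (fun x => ‖g x‖ ^ 2) μ)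
    {k : S → S → ℝ} (hkm : Measurable (Function.uncurry k)) {M : ℝ} (hkM : ∀ s s', k s s' ≤ M)
    (hsymm : ∀ s s', k s s' = k s' s)
    (hker : ∀ s s', ‖∫ x, e s x * (starRingEnd ℂ) (e s' x) ∂μ‖ ≤ k s s')
    {B : ℝ} (hB : 0 < B) (hkB : ∀ᵐ s ∂ν, ∫ s', k s s' ∂ν ≤ B) :
    ∫ s, ‖∫ x, e s x * g x ∂μ‖ ^ 2 ∂ν ≤ B * ∫ x, ‖g x‖ ^ 2 ∂μ := by
  set v : S → ℂ := fun s => ∫ x, e s x * g x ∂μ with hv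
  have hvm : StronglyMeasurable v :=
    (he.stronglyMeasurable.mul (hgm.comp_measurable measurable_snd)).integral_prod_right
  have hbg : Integrable (fun x => b x * ‖g x‖) μ := by
    refine Integrable.mono' (hb.add hg) (hbm.mul hgm.norm.aestronglyMeasurable)
      (Filter.Eventually.of_forall fun x => ?_)
    rw [Real.norm_eq_abs, Pi.add_apply, abs_le]
    constructor <;> nlinarith [sq_nonneg (b x + ‖g x‖), sq_nonneg (b x - ‖g x‖)]
  set W := ∫ x, b x * ‖g x‖ ∂μ
  have hvW : ∀ s, ‖v s‖ ≤ W := fun s =>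
    norm_integral_le_of_norm_le hbg (Filter.Eventually.of_forall fun x => by
      rw [norm_mul]; gcongr; exact heb s x)
  have hv2 : Integrable (fun s => ‖v s‖ ^ 2) ν :=
    Integrable.mono' (integrable_const (W ^ 2)) (hvm.norm.pow 2).aestronglyMeasurable
      (Filter.Eventually.of_forall fun s => by
        rw [Real.norm_of_nonneg (by positivity)]
        gcongr
        exact hvW s)
  have hcvm : StronglyMeasurable fun s => (starRingEnd ℂ) (v s) :=
    continuous_conj.comp_stronglyMeasurable hvm
  set h : X → ℂ := fun x => ∫ s, (starRingEnd ℂ) (v s) * e s x ∂ν with hh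
  -- `∫ ‖v‖² = ∫ g h`
  have hV : ((∫ s, ‖v s‖ ^ 2 ∂ν : ℝ) : ℂ) = ∫ x, g x * h x ∂μ := by
    have hint : Integrable (Function.uncurry fun s x => (starRingEnd ℂ) (v s) * (e s x * g x))
        (ν.prod μ) := by
      refine Integrable.mono' ((integrable_const (μ := ν) W).mul_prod hbg) ?_
        (Filter.Eventually.of_forall fun p => ?_)
      · exact ((hcvm.comp_measurable measurable_fst).mul (he.stronglyMeasurable.mul
          (hgm.comp_measurable measurable_snd))).aestronglyMeasurable
      · simp only [Function.uncurry, norm_mul, RCLike.norm_conj]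
        have := (norm_nonneg _).trans (hvW p.1)
        gcongr
        · exact hvW _
        · exact heb _ _
    calc ((∫ s, ‖v s‖ ^ 2 ∂ν : ℝ) : ℂ)
        = ∫ s, (starRingEnd ℂ) (v s) * v s ∂ν := by
          rw [← integral_complex_ofReal]
          congr 1; ext s
          rw [conj_mul']
          push_cast; rfl
      _ = ∫ s, ∫ x, (starRingEnd ℂ) (v s) * (e s x * g x) ∂μ ∂ν := by
          simp_rw [integral_const_mul]; rfl
      _ = ∫ x, ∫ s, (starRingEnd ℂ) (v s) * (e s x * g x) ∂ν ∂μ := integral_integral_swap hint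
      _ = ∫ x, g x * h x ∂μ := by
          congr 1; ext x
          rw [hh, ← integral_const_mul]
          congr 1; ext s; ring
  -- the square of the norm of `h`
  set f : X → S × S → ℂ := fun x p => ((starRingEnd ℂ) (v p.1) * e p.1 x) *
    (v p.2 * (starRingEnd ℂ) (e p.2 x)) with hf
  have hfint : Integrable (Function.uncurry f) (μ.prod (ν.prod ν)) := by
    have hem : ∀ π : S × S → S, Measurable π →
        StronglyMeasurable (fun q : X × (S × S) => e (π q.2) q.1) := fun π hπ =>
      he.stronglyMeasurable.comp_measurable
        ((hπ.comp measurable_snd).prodMk measurable_fst)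
    refine Integrable.mono' (hb.mul_prod (integrable_const (μ := ν.prod ν) (W ^ 2))) ?_
        (Filter.Eventually.of_forall fun q => ?_)
    · exact (((hcvm.comp_measurable (measurable_fst.comp measurable_snd)).mul
        (hem _ measurable_fst)).mul ((hvm.comp_measurable (measurable_snd.comp measurable_snd)).mul
        (continuous_conj.comp_stronglyMeasurable (hem _ measurable_snd)))).aestronglyMeasurable
    · simp only [Function.uncurry, hf, norm_mul, RCLike.norm_conj]
      have h0 := (norm_nonneg _).trans (hvW q.2.1)
      have h1 := (norm_nonneg _).trans (heb q.2.1 q.1)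
      calc _ ≤ (W * b q.1) * (W * b q.1) := by
            gcongr
            · exact hvW _
            · exact heb _ _
            · exact hvW _
            · exact heb _ _
        _ = _ := by ring
  have hfh : ∀ x, ∫ p, f x p ∂(ν.prod ν) = ((‖h x‖ ^ 2 : ℝ) : ℂ) := by
    intro x
    rw [hf, integral_prod_mul (fun s => (starRingEnd ℂ) (v s) * e s x)
      (fun s => v s * (starRingEnd ℂ) (e s x))]
    push_cast
    rw [← mul_conj', hh, ← integral_conj]
    simp
  have hh2 : Integrable (fun x => ‖h x‖ ^ 2) μ := by
    refine hfint.integral_prod_left.norm.congr (Filter.Eventually.of_forall fun x => ?_)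
    simp only [Function.uncurry]
    rw [hfh, norm_real, Real.norm_of_nonneg (by positivity)]
  have hkint : Integrable (fun p : S × S => ‖v p.1‖ ^ 2 * k p.1 p.2) (ν.prod ν) := by
    refine Integrable.mono' (integrable_const (W ^ 2 * M))
      (((hvm.norm.comp_measurable measurable_fst).pow 2).mul
        hkm.stronglyMeasurable).aestronglyMeasurable (Filter.Eventually.of_forall fun p => ?_)
    have h0 := (norm_nonneg _).trans (hker p.1 p.2)
    rw [Real.norm_of_nonneg (by positivity)]
    gcongr
    · exact hvW _
    · exact hkM _ _
  have hkswap : ∀ p : S × S, (fun p : S × S => ‖v p.1‖ ^ 2 * k p.1 p.2) p.swap =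
      ‖v p.2‖ ^ 2 * k p.1 p.2 := fun p => by simp [hsymm p.2 p.1]
  have hkint' : Integrable (fun p : S × S => ‖v p.2‖ ^ 2 * k p.1 p.2) (ν.prod ν) :=
    hkint.swap.congr (Filter.Eventually.of_forall hkswap)
  have hH : ∫ x, ‖h x‖ ^ 2 ∂μ ≤ B * ∫ s, ‖v s‖ ^ 2 ∂ν := by
    calc ∫ x, ‖h x‖ ^ 2 ∂μ = ‖∫ x, ∫ p, f x p ∂(ν.prod ν) ∂μ‖ := by
          simp_rw [hfh]
          rw [integral_complex_ofReal, norm_real, Real.norm_of_nonneg]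
          exact integral_nonneg fun x => by positivity
      _ = ‖∫ p, ∫ x, f x p ∂μ ∂(ν.prod ν)‖ := by rw [integral_integral_swap hfint]
      _ ≤ ∫ p : S × S, (‖v p.1‖ ^ 2 * k p.1 p.2 + ‖v p.2‖ ^ 2 * k p.1 p.2) / 2 ∂(ν.prod ν) := by
          refine norm_integral_le_of_norm_le ((hkint.add hkint').div_const 2)
            (Filter.Eventually.of_forall fun p => ?_)
          have h1 : ∫ x, f x p ∂μ = ((starRingEnd ℂ) (v p.1) * v p.2) *
              ∫ x, e p.1 x * (starRingEnd ℂ) (e p.2 x) ∂μ := by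
            rw [← integral_const_mul]
            congr 1; ext x
            simp only [hf]; ring
          rw [h1, norm_mul, norm_mul, RCLike.norm_conj]
          have h0 := (norm_nonneg _).trans (hker p.1 p.2)
          calc _ ≤ ‖v p.1‖ * ‖v p.2‖ * k p.1 p.2 := by gcongr; exact hker _ _
            _ ≤ _ := by nlinarith [mul_nonneg (sq_nonneg (‖v p.1‖ - ‖v p.2‖)) h0]
      _ = ∫ p : S × S, ‖v p.1‖ ^ 2 * k p.1 p.2 ∂(ν.prod ν) := by
          have hsw := integral_prod_swap (μ := ν) (ν := ν)
            (fun p : S × S => ‖v p.1‖ ^ 2 * k p.1 p.2)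
          simp_rw [hkswap] at hsw
          rw [integral_div, integral_add hkint hkint', hsw]
          ring
      _ = ∫ s, ‖v s‖ ^ 2 * ∫ s', k s s' ∂ν ∂ν := by
          rw [integral_prod _ hkint]
          simp_rw [integral_const_mul]
      _ ≤ ∫ s, ‖v s‖ ^ 2 * B ∂ν := by
          refine integral_mono_ae ?_ (hv2.mul_const B) ?_
          · have := hkint.integral_prod_left
            simpa only [integral_const_mul] using this
          · filter_upwards [hkB] with s hs
            gcongr
      _ = _ := by rw [integral_mul_const, mul_comm]
  have hfinal : ∫ s, ‖v s‖ ^ 2 ∂ν ≤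
      ∫ x, (B * ‖g x‖ ^ 2 + B⁻¹ * ‖h x‖ ^ 2) / 2 ∂μ := by
    calc ∫ s, ‖v s‖ ^ 2 ∂ν = ‖∫ x, g x * h x ∂μ‖ := by
          rw [← hV, norm_real, Real.norm_of_nonneg]
          exact integral_nonneg fun x => by positivity
      _ ≤ _ := by
          refine norm_integral_le_of_norm_le (((hg.const_mul B).add (hh2.const_mul B⁻¹)).div_const 2)
            (Filter.Eventually.of_forall fun x => ?_)
          rw [norm_mul]
          have h1 : B * ‖g x‖ ^ 2 + B⁻¹ * ‖h x‖ ^ 2 - 2 * (‖g x‖ * ‖h x‖) =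
              B⁻¹ * (B * ‖g x‖ - ‖h x‖) ^ 2 := by field_simp; ring
          have h2 : 0 ≤ B⁻¹ * (B * ‖g x‖ - ‖h x‖) ^ 2 := by positivity
          linarith
  rw [integral_div, integral_add (hg.const_mul B) (hh2.const_mul B⁻¹), integral_const_mul,
    integral_const_mul] at hfinal
  have h1 : B⁻¹ * ∫ x, ‖h x‖ ^ 2 ∂μ ≤ ∫ s, ‖v s‖ ^ 2 ∂ν := by
    rw [inv_mul_le_iff₀ hB]; exact hH
  linarith

end TTStar

section LogKernel

theorem hasDerivAt_log_one_add_mul {l : ℝ} (hl : 0 < l) {x : ℝ} (hx : 0 ≤ x) :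
    HasDerivAt (fun x => Real.log (1 + l * x) / l) (1 + l * x)⁻¹ x := by
  have h1 : 0 < 1 + l * x := by positivity
  have := (((hasDerivAt_id x).const_mul l).const_add 1).log h1.ne' |>.div_const l
  refine this.congr_deriv ?_
  simp only [id_eq]
  field_simp

theorem integral_inv_one_add_mul {l a : ℝ} (hl : 0 < l) (ha : 0 ≤ a) :
    ∫ x in (0 : ℝ)..a, (1 + l * x)⁻¹ = Real.log (1 + l * a) / l := by
  have hpos : ∀ x ∈ Set.uIcc 0 a, 0 ≤ x := fun x hx => by
    rw [Set.uIcc_of_le ha] at hx; exact hx.1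
  rw [intervalIntegral.integral_eq_sub_of_hasDerivAt
    (f := fun x => Real.log (1 + l * x) / l)
    (fun x hx => hasDerivAt_log_one_add_mul hl (hpos x hx))]
  · simp
  · refine ContinuousOn.intervalIntegrable (ContinuousOn.inv₀ (by fun_prop) fun x hx => ?_)
    have := hpos x hx
    positivity

theorem integral_inv_one_add_mul_abs_sub_le {l t s : ℝ} (hl : 0 < l) (hs : 0 ≤ s) (hst : s ≤ t) :
    ∫ x in (0 : ℝ)..t, (1 + l * |s - x|)⁻¹ ≤ 2 * Real.log (1 + l * t) / l := by
  have hint : ∀ a b, IntervalIntegrable (fun x => (1 + l * |s - x|)⁻¹) volume a b := fun a b =>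
    Continuous.intervalIntegrable (by
      refine Continuous.inv₀ (by fun_prop) fun x => ?_
      positivity) a b
  rw [← intervalIntegral.integral_add_adjacent_intervals (hint 0 s) (hint s t)]
  have h1 : ∫ x in (0 : ℝ)..s, (1 + l * |s - x|)⁻¹ = Real.log (1 + l * s) / l := by
    rw [← integral_inv_one_add_mul hl hs]
    have := intervalIntegral.integral_comp_sub_left (a := 0) (b := s) (fun x => (1 + l * x)⁻¹) s
    rw [sub_self, sub_zero] at this
    rw [← this]
    refine intervalIntegral.integral_congr fun x hx => ?_
    rw [Set.uIcc_of_le hs] at hx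
    rw [abs_of_nonneg (by linarith [hx.2])]
  have h2 : ∫ x in s..t, (1 + l * |s - x|)⁻¹ = Real.log (1 + l * (t - s)) / l := by
    rw [← integral_inv_one_add_mul hl (sub_nonneg.2 hst)]
    have := intervalIntegral.integral_comp_sub_right (a := s) (b := t) (fun x => (1 + l * x)⁻¹) s
    rw [sub_self] at this
    rw [← this]
    refine intervalIntegral.integral_congr fun x hx => ?_
    rw [Set.uIcc_of_le hst] at hx
    rw [abs_of_nonpos (by linarith [hx.1]), neg_sub]
  rw [h1, h2, ← add_div]
  gcongr
  have h3 : Real.log (1 + l * s) ≤ Real.log (1 + l * t) :=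
    Real.log_le_log (by positivity) (by gcongr)
  have h4 : Real.log (1 + l * (t - s)) ≤ Real.log (1 + l * t) :=
    Real.log_le_log (by have := sub_nonneg.2 hst; positivity) (by gcongr; linarith)
  linarith

end LogKernel

section Strichartz

open scoped FourierTransform

/-- Measurable choice of near-maximizers for a family which is Lipschitz in time. -/
theorem exists_measurable_iSup_le {Y : Type*} [MeasurableSpace Y] [Nonempty Y] {T : ℝ → Y → ℝ}
    {A L : ℝ} (hA : ∀ s x, T s x ≤ A) (hL : ∀ s s' x, T s x ≤ T s' x + L * |s - s'|)
    {δ : ℝ} (hδ : 0 < δ) :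
    ∃ X : ℝ → Y, Measurable X ∧ ∀ s, ⨆ x, T s x ≤ T s (X s) + δ := by
  have hbdd : ∀ s, BddAbove (Set.range (T s)) := fun s => ⟨A, by rintro _ ⟨x, rfl⟩; exact hA s x⟩
  set τ := δ / (4 * (|L| + 1)) with hτ
  have hτ0 : 0 < τ := by positivity
  have hsel : ∀ n : ℤ, ∃ x, ⨆ x, T (n * τ) x < T (n * τ) x + δ / 2 := fun n => by
    obtain ⟨x, hx⟩ := exists_lt_of_lt_ciSup (sub_lt_self (⨆ x, T (n * τ) x) (half_pos hδ))
    exact ⟨x, by linarith⟩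
  choose X hX using hsel
  refine ⟨fun s => X ⌊s / τ⌋, measurable_from_top.comp
    (Int.measurable_floor.comp (measurable_id.div_const τ)), fun s => ?_⟩
  set n := ⌊s / τ⌋
  have h1 : |s - n * τ| ≤ τ := by
    have h2 := Int.floor_le (s / τ)
    have h3 := Int.lt_floor_add_one (s / τ)
    rw [le_div_iff₀ hτ0] at h2
    rw [div_lt_iff₀ hτ0] at h3
    rw [abs_le]
    constructor <;> linarith
  have h2 : L * |s - n * τ| ≤ δ / 4 := by
    calc L * |s - n * τ| ≤ (|L| + 1) * τ := by
          gcongr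
          linarith [le_abs_self L]
      _ = δ / 4 := by rw [hτ]; field_simp
  have h3 : ⨆ x, T s x ≤ (⨆ x, T (n * τ) x) + δ / 4 := ciSup_le fun x => by
    have := le_ciSup (hbdd (n * τ)) x
    linarith [hL s (n * τ) x]
  have h4 := hL (n * τ) s (X n)
  rw [abs_sub_comm] at h4
  linarith [hX n]

variable {V : Type*} [NormedAddCommGroup V] [InnerProductSpace ℝ V] [FiniteDimensional ℝ V]
  [MeasurableSpace V] [BorelSpace V]

/-- Convolution with the kernel of a Fourier multiplier, on the frequency side. -/
theorem integral_kernel_mul_eq {φ : V → ℂ} (hφ : Continuous φ) (hφc : HasCompactSupport φ)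
    (u : SchwartzMap V ℂ) (s : ℝ) (x : V) :
    ∫ y, (∫ ξ, exp (I * ((⟪y, ξ⟫ - s * √‖ξ‖ : ℝ) : ℂ)) * φ ξ) * u (x - y) =
      ∫ ξ, (exp (I * ((⟪x, ξ⟫ - s * √‖ξ‖ : ℝ) : ℂ)) * φ ξ) * 𝓕 u ((2 * Real.pi)⁻¹ • ξ) := by
  have hint : Integrable (Function.uncurry fun (y ξ : V) =>
      (exp (I * ((⟪y, ξ⟫ - s * √‖ξ‖ : ℝ) : ℂ)) * φ ξ) * u (x - y)) (volume.prod volume) := by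
    have hu : Integrable fun y => ‖u (x - y)‖ := (u.integrable.comp_sub_left x).norm
    have hc : Continuous u := u.continuous
    refine Integrable.mono' (hu.mul_prod (hφ.integrable_of_hasCompactSupport hφc).norm)
      (Continuous.aestronglyMeasurable (by unfold Function.uncurry; fun_prop))
      (Filter.Eventually.of_forall fun p => ?_)
    simp only [Function.uncurry]
    rw [norm_mul, norm_exp_I_mul_ofReal_mul, mul_comm]
  simp_rw [← integral_mul_const]
  rw [integral_integral_swap hint]
  congr 1
  ext ξ
  rw [← integral_sub_left_eq_self _ volume x]
  have hF : 𝓕 u ((2 * Real.pi)⁻¹ • ξ) = ∫ y, exp (-I * (⟪y, ξ⟫ : ℝ)) * u y := by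
    rw [SchwartzMap.fourier_coe, Real.fourier_eq']
    congr 1
    ext y
    rw [smul_eq_mul, inner_smul_right]
    congr 2
    have : (Real.pi : ℂ) ≠ 0 := by exact_mod_cast Real.pi_ne_zero
    push_cast
    field_simp
  rw [hF, ← integral_const_mul]
  congr 1
  ext y
  have h : exp (I * ((⟪x - y, ξ⟫ - s * √‖ξ‖ : ℝ) : ℂ)) =
      exp (I * ((⟪x, ξ⟫ - s * √‖ξ‖ : ℝ) : ℂ)) * exp (-I * (⟪y, ξ⟫ : ℝ)) := by
    rw [← Complex.exp_add, inner_sub_left]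
    congr 1
    push_cast
    ring
  rw [h, sub_sub_cancel]
  ring

theorem norm_exp_sub_exp_le (a b : ℝ) : ‖exp (I * (a : ℂ)) - exp (I * (b : ℂ))‖ ≤ |a - b| := by
  have h : exp (I * (a : ℂ)) - exp (I * (b : ℂ)) =
      exp (I * (b : ℂ)) * (exp (I * ((a - b : ℝ) : ℂ)) - 1) := by
    rw [mul_sub, ← Complex.exp_add, mul_one]
    congr 2
    push_cast
    ring
  rw [h, norm_exp_I_mul_ofReal_mul]
  exact Real.norm_exp_I_mul_ofReal_sub_one_le

/-- The `L² → L²([0,t]) L^∞` bound on the frequency side, with the constant given by the `TT*`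
argument. -/
theorem integral_iSup_norm_sq_le {φ g : V → ℂ} (hφ : Continuous φ)
    (hφc : HasCompactSupport φ) (hg : Continuous g) (hg2 : Integrable fun ξ => ‖g ξ‖ ^ 2)
    {D l : ℝ} (hD : 0 < D) (hl : 0 < l)
    (hdisp : ∀ (s : ℝ) (z : V), ‖∫ ξ, exp (I * ((⟪z, ξ⟫ - s * √‖ξ‖ : ℝ) : ℂ)) *
      (φ ξ * (starRingEnd ℂ) (φ ξ))‖ ≤ D / (1 + l * |s|)) {t : ℝ} (ht : 0 < t) :
    ∫ s in (0 : ℝ)..t, (⨆ x : V,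
        ‖∫ ξ, (exp (I * ((⟪x, ξ⟫ - s * √‖ξ‖ : ℝ) : ℂ)) * φ ξ) * g ξ‖) ^ 2 ≤
      2 * (D * (2 * Real.log (1 + l * t) / l) * ∫ ξ, ‖g ξ‖ ^ 2) := by
  set T : ℝ → V → ℂ := fun s x =>
    ∫ ξ, (exp (I * ((⟪x, ξ⟫ - s * √‖ξ‖ : ℝ) : ℂ)) * φ ξ) * g ξ with hT
  have hint : ∀ s x, Integrable fun ξ => (exp (I * ((⟪x, ξ⟫ - s * √‖ξ‖ : ℝ) : ℂ)) * φ ξ) * g ξ :=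
    fun s x => Continuous.integrable_of_hasCompactSupport (by fun_prop) hφc.mul_left.mul_right
  have hintA : Integrable fun ξ => ‖φ ξ * g ξ‖ :=
    (Continuous.integrable_of_hasCompactSupport (by fun_prop) hφc.mul_right).norm
  have hintL : Integrable fun ξ => √‖ξ‖ * ‖φ ξ * g ξ‖ :=
    Continuous.integrable_of_hasCompactSupport (by fun_prop) hφc.mul_right.norm.mul_left
  have hTA : ∀ s x, ‖T s x‖ ≤ ∫ ξ, ‖φ ξ * g ξ‖ := fun s x =>
    norm_integral_le_of_norm_le hintA (Filter.Eventually.of_forall fun ξ => by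
      rw [mul_assoc, norm_exp_I_mul_ofReal_mul])
  have hTL : ∀ s s' x, ‖T s x‖ ≤ ‖T s' x‖ + (∫ ξ, √‖ξ‖ * ‖φ ξ * g ξ‖) * |s - s'| := by
    intro s s' x
    have h1 : ‖T s x - T s' x‖ ≤ (∫ ξ, √‖ξ‖ * ‖φ ξ * g ξ‖) * |s - s'| := by
      rw [hT, ← integral_sub (hint s x) (hint s' x), ← integral_mul_const]
      refine norm_integral_le_of_norm_le (hintL.mul_const _) (Filter.Eventually.of_forall fun ξ => ?_)
      rw [mul_assoc, mul_assoc, ← sub_mul, norm_mul, mul_right_comm]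
      gcongr
      refine (norm_exp_sub_exp_le _ _).trans_eq ?_
      rw [← abs_of_nonneg (Real.sqrt_nonneg ‖ξ‖), ← abs_mul, ← abs_neg,
        abs_of_nonneg (Real.sqrt_nonneg ‖ξ‖)]
      congr 1
      ring
    have := norm_sub_norm_le (T s x) (T s' x)
    linarith
  have hlog : 0 < Real.log (1 + l * t) := Real.log_pos (by linarith [mul_pos hl ht])
  set B := D * (2 * Real.log (1 + l * t) / l) with hB
  have hB0 : 0 < B := by positivity
  refine le_of_forall_pos_le_add fun η hη => ?_
  set δ := √(η / (2 * t)) with hδ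
  have hδ0 : 0 < δ := Real.sqrt_pos.2 (by positivity)
  have hδ2 : 2 * δ ^ 2 * t = η := by
    rw [hδ, Real.sq_sqrt (by positivity)]
    field_simp
  obtain ⟨X, hXm, hX⟩ := exists_measurable_iSup_le (T := fun s x => ‖T s x‖) hTA hTL hδ0
  set e : ℝ → V → ℂ := fun s ξ => exp (I * ((⟪X s, ξ⟫ - s * √‖ξ‖ : ℝ) : ℂ)) * φ ξ with he
  have hem : Measurable (Function.uncurry e) := by
    have h1 : Continuous fun q : V × ℝ × V =>
        exp (I * ((⟪q.1, q.2.2⟫ - q.2.1 * √‖q.2.2‖ : ℝ) : ℂ)) * φ q.2.2 := by fun_prop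
    exact h1.measurable.comp ((hXm.comp measurable_fst).prodMk measurable_id)
  have hmain := integral_norm_sq_le_of_schur (ν := volume.restrict (Set.Ioc 0 t))
    (μ := (volume : Measure V)) hem (b := fun ξ => ‖φ ξ‖) hφ.norm.aestronglyMeasurable
    (Continuous.integrable_of_hasCompactSupport (by fun_prop)
      (hφc.norm.comp_left (g := fun r : ℝ => r ^ 2) (by norm_num)))
    (fun s ξ => (norm_exp_I_mul_ofReal_mul _ _).le) hg.stronglyMeasurable hg2
    (k := fun s s' => D / (1 + l * |s - s'|)) (by unfold Function.uncurry; fun_prop) (M := D)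
    (fun s s' => div_le_self hD.le (by
      have : 0 ≤ l * |s - s'| := by positivity
      linarith))
    (fun s s' => by rw [abs_sub_comm]) (fun s s' => by
      refine le_of_eq_of_le ?_ (hdisp (s - s') (X s - X s'))
      congr 2
      ext ξ
      have h1 : exp (I * ((⟪X s - X s', ξ⟫ - (s - s') * √‖ξ‖ : ℝ) : ℂ)) =
          exp (I * ((⟪X s, ξ⟫ - s * √‖ξ‖ : ℝ) : ℂ)) *
            (starRingEnd ℂ) (exp (I * ((⟪X s', ξ⟫ - s' * √‖ξ‖ : ℝ) : ℂ))) := by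
        rw [← exp_conj, map_mul, conj_I, conj_ofReal, ← Complex.exp_add, inner_sub_left]
        congr 1
        push_cast
        ring
      rw [h1]
      simp only [he, map_mul]
      ring) hB0 (by
      refine (ae_restrict_iff' measurableSet_Ioc).2 (Filter.Eventually.of_forall fun s hs => ?_)
      rw [← intervalIntegral.integral_of_le ht.le]
      simp_rw [div_eq_mul_inv D]
      rw [intervalIntegral.integral_const_mul, hB]
      gcongr
      exact integral_inv_one_add_mul_abs_sub_le hl hs.1.le hs.2)
  have hvm : StronglyMeasurable fun s => T s (X s) :=
    (hem.stronglyMeasurable.mul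
      (hg.stronglyMeasurable.comp_measurable measurable_snd)).integral_prod_right
  have hv2 : Integrable (fun s => ‖T s (X s)‖ ^ 2) (volume.restrict (Set.Ioc 0 t)) :=
    Integrable.mono' (integrable_const ((∫ ξ, ‖φ ξ * g ξ‖) ^ 2))
      (hvm.norm.pow 2).aestronglyMeasurable (Filter.Eventually.of_forall fun s => by
        rw [Real.norm_of_nonneg (by positivity)]
        gcongr
        exact hTA _ _)
  rw [intervalIntegral.integral_of_le ht.le]
  calc ∫ s in Set.Ioc 0 t, (⨆ x : V, ‖T s x‖) ^ 2
      ≤ ∫ s in Set.Ioc 0 t, (2 * ‖T s (X s)‖ ^ 2 + 2 * δ ^ 2) := by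
        refine integral_mono_of_nonneg (Filter.Eventually.of_forall fun s => sq_nonneg _)
          ((hv2.const_mul 2).add (integrable_const _)) (Filter.Eventually.of_forall fun s => ?_)
        have h0 : 0 ≤ ⨆ x : V, ‖T s x‖ := Real.iSup_nonneg fun x => norm_nonneg _
        have h1 := hX s
        calc (⨆ x : V, ‖T s x‖) ^ 2 ≤ (‖T s (X s)‖ + δ) ^ 2 := by gcongr
          _ ≤ 2 * ‖T s (X s)‖ ^ 2 + 2 * δ ^ 2 := by nlinarith [sq_nonneg (‖T s (X s)‖ - δ)]
    _ = 2 * (∫ s in Set.Ioc 0 t, ‖T s (X s)‖ ^ 2) + 2 * δ ^ 2 * t := by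
        rw [integral_add (hv2.const_mul 2) (integrable_const _), integral_const_mul]
        simp [ht.le]
        ring
    _ ≤ _ := by
        rw [hδ2]
        gcongr

theorem integral_norm_sq_fourier_smul (hd : Module.finrank ℝ V = 2) (u : SchwartzMap V ℂ) :
    ∫ ξ, ‖𝓕 u ((2 * Real.pi)⁻¹ • ξ)‖ ^ 2 = (2 * Real.pi) ^ 2 * ∫ x, ‖u x‖ ^ 2 := by
  rw [Measure.integral_comp_inv_smul volume (fun ξ => ‖𝓕 u ξ‖ ^ 2), hd,
    SchwartzMap.integral_norm_sq_fourier, abs_of_nonneg (by positivity), smul_eq_mul]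

theorem toReal_eLpNorm_two_sq (u : SchwartzMap V ℂ) :
    (eLpNorm u 2 volume).toReal ^ 2 = ∫ x, ‖u x‖ ^ 2 := by
  rw [(u.memLp 2 volume).eLpNorm_eq_integral_rpow_norm (by norm_num) (by norm_num),
    ENNReal.toReal_ofReal (by positivity), ← Real.rpow_natCast, ← Real.rpow_mul (by positivity)]
  simp

theorem log_one_add_sqrt_zpow_mul_le (k : ℤ) {t : ℝ} (ht : 0 < t) :
    Real.log (1 + √((2 : ℝ) ^ k) * t) ≤ ((max k 0 : ℤ) : ℝ) + Real.log (1 + t) := by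
  have h1 : √((2 : ℝ) ^ k) ≤ (2 : ℝ) ^ (max k 0) := by
    have h2 : (2 : ℝ) ^ k ≤ (2 : ℝ) ^ (max k 0) := zpow_le_zpow_right₀ (by norm_num) (le_max_left _ _)
    have h3 : (1 : ℝ) ≤ (2 : ℝ) ^ (max k 0) := one_le_zpow₀ (by norm_num) (le_max_right _ _)
    rw [Real.sqrt_le_left (by positivity)]
    nlinarith
  have h3 : (1 : ℝ) ≤ (2 : ℝ) ^ (max k 0) := one_le_zpow₀ (by norm_num) (le_max_right _ _)
  have h4 : 0 < √((2 : ℝ) ^ k) := by positivity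
  calc Real.log (1 + √((2 : ℝ) ^ k) * t) ≤ Real.log ((2 : ℝ) ^ (max k 0) * (1 + t)) := by
        refine Real.log_le_log (by positivity) ?_
        nlinarith [mul_le_mul_of_nonneg_right h1 ht.le]
    _ = ((max k 0 : ℤ) : ℝ) * Real.log 2 + Real.log (1 + t) := by
        rw [Real.log_mul (by positivity) (by positivity), Real.log_zpow]
    _ ≤ _ := by
        have h5 : (0 : ℝ) ≤ ((max k 0 : ℤ) : ℝ) := by exact_mod_cast le_max_right k 0
        have h6 : Real.log 2 ≤ 1 := by linarith [Real.log_two_lt_d9]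
        nlinarith

theorem rpow_three_quarters_sq (k : ℤ) :
    ((2 : ℝ) ^ (3 * (k : ℝ) / 4)) ^ 2 * √((2 : ℝ) ^ k) = ((2 : ℝ) ^ k) ^ 2 := by
  rw [Real.sqrt_eq_rpow, ← Real.rpow_intCast, ← Real.rpow_natCast, ← Real.rpow_natCast,
    ← Real.rpow_mul (by norm_num), ← Real.rpow_mul (by norm_num), ← Real.rpow_mul (by norm_num),
    ← Real.rpow_add (by norm_num)]
  congr 1
  push_cast
  ring

end Strichartz

/-- `L²_x → L²([0,t]) L^∞_x` Strichartz estimate with logarithmic loss for the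
frequency-localized evolution `e^{-isΛ}` of the gravity water wave equation
(Lemma `dispersiveTT*` (i) of the paper). -/
theorem stmt7 (ψ : EuclideanSpace ℝ (Fin 2) → ℂ) (hψ : ContDiff ℝ (⊤ : ℕ∞) ψ)
    (hsupp : tsupport ψ ⊆ {ξ : EuclideanSpace ℝ (Fin 2) | 1 / 4 ≤ ‖ξ‖ ∧ ‖ξ‖ ≤ 2}) :
    ∃ C : ℝ, 0 < C ∧
      ∀ (k : ℤ) (t : ℝ), 0 < t →
      ∀ u : SchwartzMap (EuclideanSpace ℝ (Fin 2)) ℂ,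
        Real.sqrt (∫ s in (0 : ℝ)..t,
            (⨆ x : EuclideanSpace ℝ (Fin 2),
              ‖∫ y : EuclideanSpace ℝ (Fin 2), waveKernel ψ k s y * u (x - y)‖) ^ 2) ≤
          C * (2 : ℝ) ^ (3 * (k : ℝ) / 4) *
            (Real.sqrt ((max k 0 : ℤ) : ℝ) + Real.sqrt (Real.log (1 + t))) *
            (eLpNorm (⇑u) 2 volume).toReal := by
  have hd : Module.finrank ℝ (EuclideanSpace ℝ (Fin 2)) = 2 := by simp
  have hsq : ContDiff ℝ (⊤ : ℕ∞) fun ξ => ψ ξ * (starRingEnd ℂ) (ψ ξ) :=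
    hψ.mul (Complex.conjCLE.contDiff.comp hψ)
  obtain ⟨D, hD, hdisp⟩ := exists_dispersive_scaled hd hsq
    ((closure_mono fun ξ hξ => left_ne_zero_of_mul hξ).trans hsupp)
    (fun ξ => by rw [map_mul, conj_conj, mul_comm])
  have hψc : HasCompactSupport ψ :=
    (isCompact_closedBall 0 2).of_isClosed_subset (isClosed_tsupport _)
      fun ξ hξ => by simpa using (hsupp hξ).2
  refine ⟨√(16 * Real.pi ^ 2 * D), by positivity, fun k t ht u => ?_⟩
  have hl : (0 : ℝ) < 2 ^ k := by positivity
  have hsl : 0 < √((2 : ℝ) ^ k) := Real.sqrt_pos.2 hl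
  have hφ : Continuous fun ξ => ψ ((2 : ℝ) ^ (-k) • ξ) := hψ.continuous.comp (by fun_prop)
  have hφc : HasCompactSupport fun ξ => ψ ((2 : ℝ) ^ (-k) • ξ) :=
    hψc.comp_smul (by positivity)
  simp only [waveKernel]
  simp_rw [integral_kernel_mul_eq hφ hφc u]
  have hg : Continuous fun ξ => FourierTransform.fourier u ((2 * Real.pi)⁻¹ • ξ) :=
    (FourierTransform.fourier u).continuous.comp (by fun_prop)
  have hg2 : Integrable fun ξ => ‖FourierTransform.fourier u ((2 * Real.pi)⁻¹ • ξ)‖ ^ 2 :=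
    (((FourierTransform.fourier u).memLp 2).integrable_norm_pow (by norm_num)).comp_smul
      (R := (2 * Real.pi)⁻¹) (by positivity)
  have hmain := integral_iSup_norm_sq_le hφ hφc hg hg2 (D := D * ((2 : ℝ) ^ k) ^ 2)
    (by positivity) hsl (fun s z => by
      have := hdisp _ hl s z
      rwa [← zpow_neg] at this) ht
  rw [integral_norm_sq_fourier_smul hd, ← toReal_eLpNorm_two_sq] at hmain
  have hlog := log_one_add_sqrt_zpow_mul_le k ht
  have hk0 : (0 : ℝ) ≤ ((max k 0 : ℤ) : ℝ) := by exact_mod_cast le_max_right k 0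
  have ht0 : 0 ≤ Real.log (1 + t) := Real.log_nonneg (by linarith)
  have hsum : ((max k 0 : ℤ) : ℝ) + Real.log (1 + t) ≤
      (√((max k 0 : ℤ) : ℝ) + √(Real.log (1 + t))) ^ 2 := by
    rw [add_sq, Real.sq_sqrt hk0, Real.sq_sqrt ht0]
    have : 0 ≤ 2 * √((max k 0 : ℤ) : ℝ) * √(Real.log (1 + t)) := by positivity
    linarith
  refine Real.sqrt_le_iff.2 ⟨by positivity, hmain.trans ?_⟩
  have hR (Q S N : ℝ) : (√(16 * Real.pi ^ 2 * D) * Q * S * N) ^ 2 =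
      16 * Real.pi ^ 2 * D * Q ^ 2 * S ^ 2 * N ^ 2 := by
    rw [mul_pow, mul_pow, mul_pow, Real.sq_sqrt (by positivity)]
  rw [hR, ← rpow_three_quarters_sq k]
  set N := (eLpNorm (⇑u) 2 volume).toReal
  set Q := (2 : ℝ) ^ (3 * (k : ℝ) / 4)
  calc _ = 16 * Real.pi ^ 2 * D * Q ^ 2 * Real.log (1 + √((2 : ℝ) ^ k) * t) * N ^ 2 := by
        field_simp
        ring
    _ ≤ _ := by
        gcongr
        exact hlog.trans hsum

end
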